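/- Let n ≥ 1 and let π ∈ S_n. Then |O_n^{-1}(π)| = ∏_{j=1}^{n} |Ω_j(π)| if and only if π avoids both the pattern 321 and the pattern 3412. -/

import Mathlib

open Finset

namespace MVPPark

/-- One step of the MVP parking process: car `c`, preferring spot `p`, arrives at the
state `state` (recording, for each spot, the car parked there, if any).  Car `c` always
parks in spot `p`; if spot `p` was occupied by an (earlier) car `j`, then `j` is bumped
and parks in the first unoccupied spot strictly beyond `p`, if such a spot exists
(otherwise `j` drives off unparked). -/
def mvpStep {n : ℕ} (state : Fin n → Option (Fin n)) (c p : Fin n) :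
    Fin n → Option (Fin n) :=
  match state p with
  | none => Function.update state p (some c)
  | some j =>
    match (List.finRange n).find? (fun k => decide (p < k) && (state k).isNone) with
    | none => Function.update state p (some c)
    | some k => Function.update (Function.update state p (some c)) k (some j)

/-- The final state of the MVP parking process with preference list `α`:
cars `0, 1, …, n-1` enter in order, car `i` preferring spot `α i`. -/
def mvpRun {n : ℕ} (α : Fin n → Fin n) : Fin n → Option (Fin n) :=
  (List.finRange n).foldl (fun st c => mvpStep st c (α c)) (fun _ => none)

/-- `α` is an MVP parking function: under the MVP rule, all `n` cars end up parked. -/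
def IsMVP {n : ℕ} (α : Fin n → Fin n) : Prop :=
  ∀ c : Fin n, ∃ j : Fin n, mvpRun α j = some c

/-- The outcome of the MVP parking process on `α` is the permutation `π`:
for each `j`, spot `j` ends up occupied by car `π j`. -/
def MvpOutcome {n : ℕ} (α : Fin n → Fin n) (π : Equiv.Perm (Fin n)) : Prop :=
  ∀ j : Fin n, mvpRun α j = some (π j)

end MVPPark

namespace MVPPark

/-- `C_j(π)`: the set of cars arriving after car `π j` that park to the left of
spot `j`, together with car `π j` itself. -/
def Cset {n : ℕ} (π : Equiv.Perm (Fin n)) (j : Fin n) : Finset (Fin n) :=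
  ((Finset.univ.filter (fun k => k < j)).image π ∩
      Finset.univ.filter (fun c => π j < c)) ∪ {π j}

/-- `Ω_j(π)`: the set of spots on or to the left of spot `j` occupied (in the outcome
`π`) by a car of `C_j(π)`. -/
def Omega {n : ℕ} (π : Equiv.Perm (Fin n)) (j : Fin n) : Finset (Fin n) :=
  Finset.univ.filter (fun k => k ≤ j ∧ π k ∈ Cset π j)

end MVPPark

namespace MVPPark

/-- `π` contains the pattern `321`. -/
def Contains321 {n : ℕ} (π : Equiv.Perm (Fin n)) : Prop :=
  ∃ x y z : Fin n, x < y ∧ y < z ∧ π z < π y ∧ π y < π x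

/-- `π` contains the pattern `3412`. -/
def Contains3412 {n : ℕ} (π : Equiv.Perm (Fin n)) : Prop :=
  ∃ w x y z : Fin n, w < x ∧ x < y ∧ y < z ∧ π y < π z ∧ π z < π w ∧ π w < π x

end MVPPark

namespace MVPPark

variable {n : ℕ}

lemma mvpRun_induction (α : Fin n → Fin n) (P : ℕ → (Fin n → Option (Fin n)) → Prop)
    (h0 : P 0 fun _ => none)
    (hs : ∀ (c : Fin n) st, P c st → P (c + 1) (mvpStep st c (α c))) :
    P n (mvpRun α) := by
  have key : ∀ t ≤ n, P t (((List.finRange n).take t).foldl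
      (fun st c => mvpStep st c (α c)) fun _ => none) := by
    intro t
    induction t with
    | zero => intro _; simpa using h0
    | succ t ih =>
      intro ht
      have hlen : t < (List.finRange n).length := by simpa using ht
      rw [List.take_succ_eq_append_getElem hlen, List.foldl_append]
      simpa using hs ⟨t, ht⟩ _ (ih (by omega))
  have h := key n le_rfl
  rwa [List.take_of_length_le (by simp)] at h

lemma mvpStep_of_none {st : Fin n → Option (Fin n)} {c p : Fin n} (h : st p = none) :
    mvpStep st c p = Function.update st p (some c) := by
  simp [mvpStep, h]

lemma mvpStep_of_some {st : Fin n → Option (Fin n)} {c p j k : Fin n} (h : st p = some j)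
    (hpk : p < k) (hk : st k = none) (hlt : ∀ m, p < m → m < k → st m ≠ none) :
    mvpStep st c p = Function.update (Function.update st p (some c)) k (some j) := by
  have hf : (List.finRange n).find? (fun k => decide (p < k) && (st k).isNone) = some k := by
    rw [List.find?_eq_some_iff_getElem]
    refine ⟨by simp [hpk, hk], k, by simp, by simp, ?_⟩
    intro i hi
    have := hlt ⟨i, hi.trans k.2⟩
    simp only [List.getElem_finRange, Bool.not_eq_true', Bool.and_eq_false_iff,
      decide_eq_false_iff_not]
    by_cases hpi : p < ⟨i, hi.trans k.2⟩
    · right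
      simpa using Option.isSome_iff_ne_none.2 (this hpi hi)
    · exact Or.inl hpi
  simp [mvpStep, h, hf]

lemma mvpStep_cases (st : Fin n → Option (Fin n)) (c p : Fin n) :
    mvpStep st c p = Function.update st p (some c) ∨
      ∃ j k, st p = some j ∧ p < k ∧ st k = none ∧ (∀ m, p < m → m < k → st m ≠ none) ∧
        mvpStep st c p = Function.update (Function.update st p (some c)) k (some j) := by
  cases hp : st p with
  | none => exact Or.inl (mvpStep_of_none hp)
  | some j =>
    by_cases hex : ∃ k, p < k ∧ st k = none
    · right
      obtain ⟨k, hk, hmin⟩ := exists_min_image (univ.filter fun k => p < k ∧ st k = none) id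
        (by obtain ⟨k, hk⟩ := hex; exact ⟨k, by simpa using hk⟩)
      simp only [mem_filter, mem_univ, true_and, id_eq] at hk hmin
      have hlt : ∀ m, p < m → m < k → st m ≠ none := fun m h1 h2 h3 =>
        absurd h2 (not_lt.2 (hmin m ⟨h1, h3⟩))
      exact ⟨j, k, rfl, hk.1, hk.2, hlt, mvpStep_of_some hp hk.1 hk.2 hlt⟩
    · left
      push Not at hex
      have hf : (List.finRange n).find? (fun k => decide (p < k) && (st k).isNone) = none := by
        simpa using hex
      simp [mvpStep, hp, hf]

lemma mvpStep_self (st : Fin n → Option (Fin n)) (c p : Fin n) :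
    mvpStep st c p p = some c := by
  rcases mvpStep_cases st c p with h | ⟨j, k, -, hk, -, -, h⟩
  · simp [h]
  · simp [h, Function.update_of_ne hk.ne]

lemma mvpStep_of_occupied {st : Fin n → Option (Fin n)} {c p q d : Fin n} (hq : q ≠ p)
    (h : st q = some d) : mvpStep st c p q = some d := by
  rcases mvpStep_cases st c p with h' | ⟨j, k, -, -, hk, -, h'⟩
  · rw [h', Function.update_of_ne hq, h]
  · have hqk : q ≠ k := by
      rintro rfl
      simp [h] at hk
    rw [h', Function.update_of_ne hqk, Function.update_of_ne hq, h]

/-- A car found at `q` after a step has just entered, has stayed, or was bumped to the first free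
spot. -/
lemma mvpStep_eq_some {st : Fin n → Option (Fin n)} {c p q d : Fin n}
    (h : mvpStep st c p q = some d) :
    (q = p ∧ d = c) ∨ (q ≠ p ∧ st q = some d) ∨
      (p < q ∧ st p = some d ∧ st q = none ∧ ∀ m, p < m → m < q → st m ≠ none) := by
  by_cases hq : q = p
  · subst hq
    rw [mvpStep_self] at h
    simp_all
  · rcases mvpStep_cases st c p with h' | ⟨j, k, hj, hpk, hk, hlt, h'⟩
    · rw [h', Function.update_of_ne hq] at h
      exact Or.inr (Or.inl ⟨hq, h⟩)
    · rw [h'] at h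
      by_cases hqk : q = k
      · subst hqk
        simp only [Function.update_self] at h
        exact Or.inr (Or.inr ⟨hpk, hj.trans h, hk, hlt⟩)
      · rw [Function.update_of_ne hqk, Function.update_of_ne hq] at h
        exact Or.inr (Or.inl ⟨hq, h⟩)

/-- Every car prefers a spot of its set `Ω`: one weakly to the left of its own final spot whose
final occupant is not an earlier car. -/
def Compatible (π : Equiv.Perm (Fin n)) (α : Fin n → Fin n) : Prop :=
  ∀ j, α (π j) ≤ j ∧ π j ≤ π (α (π j))

lemma mem_Omega {π : Equiv.Perm (Fin n)} {j k : Fin n} :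
    k ∈ Omega π j ↔ k ≤ j ∧ π j ≤ π k := by
  simp only [Omega, Cset, mem_filter, mem_univ, true_and, mem_union, mem_inter, mem_image,
    mem_singleton, EmbeddingLike.apply_eq_iff_eq, exists_eq_right]
  constructor
  · rintro ⟨h1, h | rfl⟩
    · exact ⟨h1, h.2.le⟩
    · exact ⟨h1, le_rfl⟩
  · rintro ⟨h1, h2⟩
    refine ⟨h1, ?_⟩
    rcases h1.eq_or_lt with rfl | h1
    · exact Or.inr rfl
    · exact Or.inl ⟨h1, lt_of_le_of_ne h2 fun h => h1.ne (π.injective h).symm⟩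

open Classical in
lemma card_compatible (π : Equiv.Perm (Fin n)) :
    #{α : Fin n → Fin n | Compatible π α} = ∏ j, #(Omega π j) := by
  rw [← Fintype.card_piFinset]
  refine card_equiv (π.symm.arrowCongr (Equiv.refl _)) fun α => ?_
  rw [mem_filter, Fintype.mem_piFinset]
  simp [mem_Omega, Compatible]

lemma MvpOutcome.compatible {π : Equiv.Perm (Fin n)} {α : Fin n → Fin n}
    (h : MvpOutcome α π) : Compatible π α := by
  have key := mvpRun_induction α
    (fun t st => ∀ q c, st q = some c → (c : ℕ) < t ∧ α c ≤ q ∧ ∃ d, st (α c) = some d ∧ c ≤ d)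
    (by simp) (by
      intro c st ih q d hd
      have old : ∀ q', st q' = some d → (d : ℕ) < c + 1 ∧ α d ≤ q' ∧
          ∃ e, mvpStep st c (α c) (α d) = some e ∧ d ≤ e := by
        intro q' hq'
        obtain ⟨h1, h2, e, he, hde⟩ := ih q' d hq'
        refine ⟨by omega, h2, ?_⟩
        by_cases hα : α d = α c
        · exact ⟨c, by rw [hα, mvpStep_self], by omega⟩
        · exact ⟨e, mvpStep_of_occupied hα he, hde⟩
      rcases mvpStep_eq_some hd with ⟨rfl, rfl⟩ | ⟨_, h1⟩ | ⟨h1, h2, -⟩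
      · exact ⟨by omega, le_rfl, d, mvpStep_self _ _ _, le_rfl⟩
      · exact old q h1
      · obtain ⟨h3, h4, h5⟩ := old _ h2
        exact ⟨h3, h4.trans h1.le, h5⟩)
  intro j
  obtain ⟨-, h1, d, hd, hjd⟩ := key j (π j) (h j)
  rw [h (α (π j))] at hd
  simp only [Option.some.injEq] at hd
  exact ⟨h1, hd ▸ hjd⟩

/-- Spot `m` can hold car `c` at time `t`: it does not finally belong to an earlier car, and no car
that has entered after `c` prefers it. -/
def Holds (π : Equiv.Perm (Fin n)) (α : Fin n → Fin n) (t : ℕ) (c m : Fin n) : Prop :=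
  α c ≤ m ∧ c ≤ π m ∧ ∀ d, c < d → (d : ℕ) < t → α d ≠ m

/-- At time `t`, car `c` has entered, and `q` is the first spot that can hold it. -/
def ParkedAt (π : Equiv.Perm (Fin n)) (α : Fin n → Fin n) (t : ℕ) (c q : Fin n) : Prop :=
  (c : ℕ) < t ∧ IsLeast {m | Holds π α t c m} q

section Avoiding

variable {π : Equiv.Perm (Fin n)} {α : Fin n → Fin n}

lemma Compatible.apply_symm (hα : Compatible π α) (c : Fin n) :
    α c ≤ π.symm c ∧ c ≤ π (α c) := by
  simpa using hα (π.symm c)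

lemma Compatible.eq_of_lt (hα : Compatible π α) (h321 : ¬ Contains321 π) {x y : Fin n}
    (hxy : x < y) (h : π y < π x) : α (π x) = x := by
  by_contra hne
  have h1 := hα x
  have h2 : π x ≠ π (α (π x)) := fun he => hne (π.injective he).symm
  exact h321 ⟨α (π x), x, y, lt_of_le_of_ne h1.1 hne, hxy, h, lt_of_le_of_ne h1.2 h2⟩

lemma Compatible.holds_symm (hα : Compatible π α) (t : ℕ) (c : Fin n) :
    Holds π α t c (π.symm c) := by
  refine ⟨(hα.apply_symm c).1, by simp, fun d hcd _ hd => ?_⟩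
  have := (hα.apply_symm d).2
  rw [hd] at this
  simp only [Equiv.apply_symm_apply] at this
  exact absurd hcd (not_lt.2 this)

lemma Compatible.parkedAt_le (hα : Compatible π α) {t : ℕ} {c q : Fin n}
    (h : ParkedAt π α t c q) : q ≤ π.symm c :=
  h.2.2 (hα.holds_symm t c)

lemma holds_succ_iff {c d m : Fin n} (hd : d < c) :
    Holds π α (c + 1) d m ↔ Holds π α c d m ∧ m ≠ α c := by
  constructor
  · rintro ⟨h1, h2, h3⟩
    exact ⟨⟨h1, h2, fun e he hec => h3 e he (by omega)⟩, (h3 c hd (by omega)).symm⟩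
  · rintro ⟨⟨h1, h2, h3⟩, h4⟩
    refine ⟨h1, h2, fun e he hec => ?_⟩
    by_cases hce : e = c
    · exact hce ▸ h4.symm
    · exact h3 e he (by omega)

/-- A spot that can next hold the car bumped from `p` is not taken. -/
lemma parkedAt_eq_of_holds (h321 : ¬ Contains321 π) (h3412 : ¬ Contains3412 π)
    (hα : Compatible π α) {t : ℕ} {c d p m : Fin n} (hct : (c : ℕ) < t) (hp : t ≤ π p)
    (hpm : p < m) (hcm : c ≤ π m) (hmc : m ≤ π.symm c) (hd : ParkedAt π α t d m) :
    d = c := by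
  by_contra hdc
  obtain ⟨j, rfl⟩ := π.surjective c
  obtain ⟨k, rfl⟩ := π.surjective d
  have hmk := hα.parkedAt_le hd
  have hdm := hd.2.1.2.1
  have hdt := hd.1
  simp only [Equiv.symm_apply_apply] at hmc hmk
  have hjk : j ≠ k := by rintro rfl; exact hdc rfl
  have aux : ∀ u v : Fin n, u < v → p < u → (π u : ℕ) < t → (π v : ℕ) < t → π u < π v := by
    intro u v huv hpu hu hv
    by_contra hlt
    have : π u ≠ π v := fun h => huv.ne (π.injective h)
    exact h321 ⟨p, u, v, hpu, huv, by omega, by omega⟩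
  have aux' : ∀ u v : Fin n, u < v → m ≤ u → π v ≤ π m → (π u : ℕ) < t → (π v : ℕ) < t →
      False := by
    intro u v huv hmu hvm hu hv
    have huv' := aux u v huv (by omega) hu hv
    rcases hmu.eq_or_lt with rfl | hmu
    · omega
    · have hpm' : π p < π m := by
        have : π p ≠ π m := fun h => hpm.ne (π.injective h)
        by_contra hlt
        exact h321 ⟨p, m, v, hpm, by omega,
          lt_of_le_of_ne hvm fun h => by have := π.injective h; omega, by omega⟩
      exact h3412 ⟨p, m, u, v, hpm, hmu, huv, huv', by omega, hpm'⟩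
  rcases lt_or_gt_of_ne hjk with h | h
  · exact aux' j k h hmc hdm hct hdt
  · exact aux' k j h hmk hcm hdt hct

/-- A spot beyond `p` that is passed over by the car bumped from `p` is taken. -/
lemma exists_parkedAt_of_not_holds (h321 : ¬ Contains321 π) (h3412 : ¬ Contains3412 π)
    (hα : Compatible π α) {t : ℕ} {c p m : Fin n} (hp : t ≤ π p)
    (hinj : ∀ d, ParkedAt π α t d p → d = c) (hc : ParkedAt π α t c p)
    (hpm : p < m) (hmc : m < π.symm c) (hm : ¬ Holds π α t c m) :
    ∃ d, ParkedAt π α t d m := by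
  obtain ⟨j, rfl⟩ := π.surjective c
  simp only [Equiv.symm_apply_apply] at hmc
  by_cases hle : π j ≤ π m
  · have hex : ∃ d : Fin n, (d : ℕ) < t ∧ α d = m := by
      by_contra hno
      push Not at hno
      exact hm ⟨hc.2.1.1.trans hpm.le, hle, fun d _ hd => hno d hd⟩
    have hne : (univ.filter fun d : Fin n => (d : ℕ) < t ∧ α d = m).Nonempty := by
      obtain ⟨d, hd⟩ := hex
      exact ⟨d, by simpa using hd⟩
    obtain ⟨d, hd, hmax⟩ := exists_max_image _ id hne
    simp only [mem_filter, mem_univ, true_and, id_eq] at hd hmax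
    refine ⟨d, hd.1, ⟨hd.2.le, hd.2 ▸ (hα.apply_symm d).2, fun e he het hem => ?_⟩, ?_⟩
    · exact absurd he (not_lt.2 (hmax e ⟨het, hem⟩))
    · intro q hq
      exact hd.2 ▸ hq.1
  · have hct := hc.1
    refine ⟨π m, by omega, by simpa using hα.holds_symm t (π m), ?_⟩
    by_contra hnl
    have hex : ∃ q, Holds π α t (π m) q ∧ q < m := by
      simpa [lowerBounds] using hnl
    classical
    have hne : (univ.filter fun q => Holds π α t (π m) q).Nonempty := by
      obtain ⟨q, hq⟩ := hex
      exact ⟨q, by simpa using hq.1⟩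
    obtain ⟨q, hq, hmin⟩ := exists_min_image _ id hne
    simp only [mem_filter, mem_univ, true_and, id_eq] at hq hmin
    have hqm : q < m := by
      obtain ⟨q', hq', hlt⟩ := hex
      exact (hmin q' hq').trans_lt hlt
    have hqp : q ≠ p := by
      rintro rfl
      have := hinj (π m) ⟨by omega, hq, fun q' hq' => hmin q' hq'⟩
      omega
    have hlt : π m < π q := lt_of_le_of_ne hq.2.1 fun h => by
      have := π.injective h; omega
    have hqt : t ≤ π q := by
      by_contra hlt'
      exact hq.2.2 (π q) hlt (by omega) (hα.eq_of_lt h321 hqm hlt)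
    have aux : ∀ u v : Fin n, u < v → v < m → t ≤ π u → t ≤ π v → False := by
      intro u v huv hvm hu hv
      by_cases h : π v < π u
      · exact h321 ⟨u, v, m, huv, hvm, by omega, h⟩
      · have : π u ≠ π v := fun h => huv.ne (π.injective h)
        exact h3412 ⟨u, v, m, j, huv, hvm, hmc, by omega, by omega, by omega⟩
    rcases lt_or_gt_of_ne hqp with h | h
    · exact aux q p h hpm hqt hp
    · exact aux p q h hqm hp hqt

/-- If the spot preferred by a new car is not `q`, cars parked at `q` are not moved. -/
lemma parkedAt_succ_of_ne {c d q : Fin n} (hd : d < c) (hq : q ≠ α c)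
    (h : ParkedAt π α c d q) : ParkedAt π α (c + 1) d q :=
  ⟨by omega, (holds_succ_iff hd).2 ⟨h.2.1, hq⟩,
    fun _ hm => h.2.2 ((holds_succ_iff hd).1 hm).1⟩

lemma ParkedAt.unique {t : ℕ} {c q q' : Fin n} (h : ParkedAt π α t c q)
    (h' : ParkedAt π α t c q') : q = q' :=
  h.2.unique h'.2

lemma Compatible.exists_parkedAt (hα : Compatible π α) {t : ℕ} {c : Fin n} (h : (c : ℕ) < t) :
    ∃ q, ParkedAt π α t c q := by
  classical
  obtain ⟨q, hq, hmin⟩ := exists_min_image (univ.filter fun q => Holds π α t c q) id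
    ⟨π.symm c, by simpa using hα.holds_symm t c⟩
  simp only [mem_filter, mem_univ, true_and, id_eq] at hq hmin
  exact ⟨q, h, hq, fun m hm => hmin m hm⟩

lemma Compatible.parkedAt_self (hα : Compatible π α) (c : Fin n) :
    ParkedAt π α (c + 1) c (α c) :=
  ⟨by omega, ⟨le_rfl, (hα.apply_symm c).2, fun _ _ _ => by omega⟩, fun _ hm => hm.1⟩

lemma parkedAt_mvpStep (h321 : ¬ Contains321 π) (h3412 : ¬ Contains3412 π)
    (hα : Compatible π α) {c : Fin n} {st : Fin n → Option (Fin n)}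
    (ih : ∀ q d, st q = some d ↔ ParkedAt π α c d q) (d q : Fin n)
    (h : ParkedAt π α (c + 1) d q) : mvpStep st c (α c) q = some d := by
  have hdc := h.1
  rcases eq_or_ne d c with rfl | hne
  · rw [h.unique (hα.parkedAt_self d), mvpStep_self]
  have hlt : d < c := by omega
  obtain ⟨p, hp⟩ := hα.exists_parkedAt (t := c) (c := d) hlt
  by_cases hpc : p = α c
  · subst hpc
    have hq := (holds_succ_iff hlt).1 h.2.1
    have hpq : α c < q := lt_of_le_of_ne (hp.2.2 hq.1) hq.2.symm
    have hpt : (c : ℕ) ≤ π (α c) := (hα.apply_symm c).2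
    have hqd := hα.parkedAt_le h
    have hinj : ∀ e, ParkedAt π α c e (α c) → e = d := by
      intro e he
      have := (ih _ _).2 he
      rw [(ih _ _).2 hp] at this
      simpa using this.symm
    rw [mvpStep_of_some ((ih _ _).2 hp) hpq]
    · simp
    · rw [Option.eq_none_iff_forall_ne_some]
      intro e he
      have he := (ih _ _).1 he
      have := parkedAt_eq_of_holds h321 h3412 hα hlt hpt hpq hq.1.2.1 hqd he
      subst this
      exact hq.2 (he.unique hp)
    · intro m hpm hmq hm
      obtain ⟨e, he⟩ := exists_parkedAt_of_not_holds h321 h3412 hα hpt hinj hp hpm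
        (hmq.trans_le hqd) (fun hh => absurd hmq (not_lt.2
          (h.2.2 ((holds_succ_iff hlt).2 ⟨hh, hpm.ne'⟩))))
      rw [(ih _ _).2 he] at hm
      simp at hm
  · rw [h.unique (parkedAt_succ_of_ne hlt hpc hp)]
    exact mvpStep_of_occupied hpc ((ih _ _).2 hp)

lemma Compatible.mvpOutcome (hα : Compatible π α) (h321 : ¬ Contains321 π)
    (h3412 : ¬ Contains3412 π) : MvpOutcome α π := by
  have key := mvpRun_induction α (fun t st => ∀ q d, st q = some d ↔ ParkedAt π α t d q)
    (by simp [ParkedAt]) (by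
      intro c st ih q d
      refine ⟨fun h => ?_, parkedAt_mvpStep h321 h3412 hα ih d q⟩
      rcases mvpStep_eq_some h with ⟨rfl, rfl⟩ | ⟨hq, h1⟩ | ⟨hpq, hp, hq, hmin⟩
      · exact hα.parkedAt_self d
      · have h1 := (ih _ _).1 h1
        exact parkedAt_succ_of_ne h1.1 hq h1
      · have hd := (ih _ _).1 hp
        have hdc : d < c := hd.1
        obtain ⟨r, hr⟩ := hα.exists_parkedAt (t := c + 1) (c := d) (by omega)
        rcases mvpStep_eq_some (parkedAt_mvpStep h321 h3412 hα ih d r hr) with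
          ⟨-, hr'⟩ | ⟨hne, hr'⟩ | ⟨hpr, -, hr', hmin'⟩
        · exact absurd hr' hdc.ne
        · exact absurd (((ih _ _).1 hr').unique hd) hne
        · rcases lt_trichotomy q r with hqr | rfl | hqr
          · exact absurd hq (hmin' q hpq hqr)
          · exact hr
          · exact absurd hr' (hmin r hpr hqr))
  intro j
  refine (key j (π j)).2 ⟨(π j).2, by simpa using hα.holds_symm n (π j), fun m hm => ?_⟩
  by_contra hlt
  have hlt : m < j := not_le.1 hlt
  have h1 : π j < π m := lt_of_le_of_ne hm.2.1 fun h => hlt.ne (π.injective h).symm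
  exact hm.2.2 _ h1 (π m).2 (hα.eq_of_lt h321 hlt h1)

end Avoiding

/-- If the cars before `T` have distinct preferences, one of them, `A`, prefers the same spot as
`T`, and the next spot after it preferred by no car before `T` is preferred by no car at all, then
`A` ends up in the latter. -/
lemma mvpRun_eq_of_bump {α : Fin n → Fin n} {A T y : Fin n}
    (hinj : ∀ c d, c < T → d < T → α c = α d → c = d) (hAT : A < T) (hA : α A = α T)
    (hTy : α T < y) (hy : ∀ c, α c ≠ y)
    (hbetween : ∀ m, α T < m → m < y → ∃ c < T, α c = m) : mvpRun α y = some A := by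
  have key := mvpRun_induction α
    (fun t st => (t ≤ T → ∀ q c, st q = some c ↔ (c : ℕ) < t ∧ α c = q) ∧
      (T < t → st y = some A)) (by simp) (by
    intro c st ih
    constructor
    · intro hcT q d
      have ih := ih.1 (by omega)
      have hnone : st (α c) = none := by
        rw [Option.eq_none_iff_forall_ne_some]
        intro e he
        obtain ⟨h1, h2⟩ := (ih _ _).1 he
        have := hinj e c (by omega) (by omega) h2
        omega
      rw [mvpStep_of_none hnone]
      by_cases hq : q = α c
      · subst hq
        simp only [Function.update_self, Option.some.injEq]
        constructor
        · rintro rfl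
          exact ⟨by omega, rfl⟩
        · rintro ⟨h1, h2⟩
          exact (hinj d c (by omega) (by omega) h2).symm
      · rw [Function.update_of_ne hq, ih]
        constructor
        · rintro ⟨h1, h2⟩
          exact ⟨by omega, h2⟩
        · rintro ⟨h1, h2⟩
          have : d ≠ c := by
            rintro rfl
            exact hq h2.symm
          exact ⟨by omega, h2⟩
    · intro hTc
      by_cases hcT : c = T
      · subst hcT
        have ih := ih.1 le_rfl
        rw [mvpStep_of_some ((ih _ _).2 ⟨hAT, hA⟩) hTy]
        · simp
        · rw [Option.eq_none_iff_forall_ne_some]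
          exact fun e he => hy e ((ih _ _).1 he).2
        · intro m h1 h2 h3
          obtain ⟨e, he, hem⟩ := hbetween m h1 h2
          rw [(ih _ _).2 ⟨he, hem⟩] at h3
          simp at h3
      · exact mvpStep_of_occupied (hy c).symm (ih.2 (by omega)))
  exact key.2 T.2

/-- Two cars `A = π a` and `B = π b` prefer the spots `p` and `q`, all others their final spots. -/
def twoMoved (π : Equiv.Perm (Fin n)) (a p b q : Fin n) : Fin n → Fin n :=
  Function.update (Function.update π.symm (π a) p) (π b) q

lemma twoMoved_apply (π : Equiv.Perm (Fin n)) (a p b q k : Fin n) :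
    twoMoved π a p b q (π k) = if k = b then q else if k = a then p else k := by
  simp [twoMoved, Function.update_apply]

lemma compatible_twoMoved {π : Equiv.Perm (Fin n)} {a p b q : Fin n} (hpa : p ≤ a)
    (hap : π a ≤ π p) (hqb : q ≤ b) (hbq : π b ≤ π q) : Compatible π (twoMoved π a p b q) := by
  intro j
  rw [twoMoved_apply]
  split_ifs with h1 h2
  · subst h1
    exact ⟨hqb, hbq⟩
  · subst h2
    exact ⟨hpa, hap⟩
  · exact ⟨le_rfl, le_rfl⟩

lemma not_contains321_of_forall_compatible {π : Equiv.Perm (Fin n)}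
    (h : ∀ α, Compatible π α → MvpOutcome α π) : ¬ Contains321 π := by
  rintro ⟨x₀, y, z, hxy₀, hyz, hzy, hyx₀⟩
  obtain ⟨x, hx, hmax⟩ := exists_max_image (univ.filter fun x => x < y ∧ π y < π x) id
    ⟨x₀, by simp [hxy₀, hyx₀]⟩
  simp only [mem_filter, mem_univ, true_and, id_eq] at hx hmax
  obtain ⟨hxy, hyx⟩ := hx
  have hout := h _ (compatible_twoMoved (π := π) (a := z) (p := x) (b := y) (q := x)
    (hxy.trans hyz).le (hzy.trans hyx).le hxy.le hyx.le) y
  have hap := twoMoved_apply π z x y x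
  have hTy : twoMoved π z x y x (π y) = x := by simp [hap]
  have := mvpRun_eq_of_bump (α := twoMoved π z x y x) (A := π z) (T := π y) (y := y) ?_ hzy
    ?_ (by rwa [hTy]) ?_ ?_
  · rw [this] at hout
    simp only [Option.some.injEq, EmbeddingLike.apply_eq_iff_eq] at hout
    omega
  · intro c d
    obtain ⟨j, rfl⟩ := π.surjective c
    obtain ⟨k, rfl⟩ := π.surjective d
    rw [hap, hap]
    intro hj hk
    have : ∀ u, π u < π y → u ≠ y ∧ u ≠ x := by
      intro u hu
      constructor <;> (rintro rfl; omega)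
    have hj' := this j hj
    have hk' := this k hk
    intro he
    congr 1
    split_ifs at he <;> omega
  · rw [hTy, hap]
    split_ifs <;> omega
  · intro c
    obtain ⟨j, rfl⟩ := π.surjective c
    rw [hap]
    split_ifs <;> omega
  · intro m h1 h2
    rw [hTy] at h1
    refine ⟨π m, ?_, ?_⟩
    · have h3 : π m ≠ π y := fun he => h2.ne (π.injective he)
      by_contra hlt
      have := hmax m ⟨h2, by omega⟩
      omega
    · rw [hap]
      split_ifs <;> omega

lemma not_contains3412_of_forall_compatible {π : Equiv.Perm (Fin n)}
    (h : ∀ α, Compatible π α → MvpOutcome α π) : ¬ Contains3412 π := by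
  have h321 := not_contains321_of_forall_compatible h
  rintro ⟨w₀, x₀, y, z, hwx₀, hxy₀, hyz, hyz', hzw₀, hwx₀'⟩
  obtain ⟨w, hw, hmax⟩ := exists_max_image
    (univ.filter fun w => π z < π w ∧ ∃ x, w < x ∧ x < y ∧ π w < π x) id
    ⟨w₀, by simpa using ⟨hzw₀, x₀, hwx₀, hxy₀, hwx₀'⟩⟩
  simp only [mem_filter, mem_univ, true_and, id_eq] at hw hmax
  obtain ⟨hzw, x, hwx, hxy, hwx'⟩ := hw
  have huniq : ∀ m, w < m → m < y → π w < π m → m = x := by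
    have aux : ∀ u v, w < u → u < v → v < y → π w < π u → π w < π v → False := by
      intro u v hwu huv hvy hu hv
      by_cases hlt : π u < π v
      · have := hmax u ⟨by omega, v, huv, hvy, hlt⟩
        omega
      · have : π u ≠ π v := fun he => huv.ne (π.injective he)
        exact h321 ⟨u, v, y, huv, hvy, by omega, by omega⟩
    intro m h1 h2 h3
    rcases lt_trichotomy m x with hm | hm | hm
    · exact (aux m x h1 hm hxy h3 hwx').elim
    · exact hm
    · exact (aux x m hwx hm h2 hwx' h3).elim
  have hout := h _ (compatible_twoMoved (π := π) (a := z) (p := w) (b := y) (q := x)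
    (by omega) hzw.le hxy.le (by omega)) y
  have hap := twoMoved_apply π z w y x
  have hTy : twoMoved π z w y x (π w) = w := by
    rw [hap]
    split_ifs <;> omega
  have := mvpRun_eq_of_bump (α := twoMoved π z w y x) (A := π z) (T := π w) (y := y) ?_ hzw
    ?_ (by rw [hTy]; omega) ?_ ?_
  · rw [this] at hout
    simp only [Option.some.injEq, EmbeddingLike.apply_eq_iff_eq] at hout
    omega
  · intro c d
    obtain ⟨j, rfl⟩ := π.surjective c
    obtain ⟨k, rfl⟩ := π.surjective d
    rw [hap, hap]
    intro hj hk
    have : ∀ u, π u < π w → u ≠ w ∧ u ≠ x := by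
      intro u hu
      constructor <;> (rintro rfl; omega)
    have hj' := this j hj
    have hk' := this k hk
    intro he
    congr 1
    split_ifs at he <;> omega
  · rw [hTy, hap]
    split_ifs <;> omega
  · intro c
    obtain ⟨j, rfl⟩ := π.surjective c
    rw [hap]
    split_ifs <;> omega
  · intro m h1 h2
    rw [hTy] at h1
    by_cases hmx : m = x
    · exact ⟨π y, by omega, by simp [hap, hmx]⟩
    · refine ⟨π m, ?_, ?_⟩
      · have h3 : π m ≠ π w := fun he => h1.ne' (π.injective he)
        by_contra hlt
        exact hmx (huniq m h1 h2 (by omega))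
      · rw [hap]
        split_ifs <;> omega

end MVPPark

open MVPPark in
/-- The fiber of the MVP outcome map over `π` has cardinality `∏_j |Ω_j(π)|` if and
only if `π` avoids both the pattern `321` and the pattern `3412`. -/
theorem fiber_eq_iff_avoids (n : ℕ) (hn : 1 ≤ n) (π : Equiv.Perm (Fin n)) :
    Nat.card {α : Fin n → Fin n // MvpOutcome α π} = ∏ j : Fin n, (Omega π j).card ↔
      (¬ Contains321 π ∧ ¬ Contains3412 π) := by
  classical
  rw [Nat.card_eq_fintype_card, Fintype.card_subtype, ← card_compatible]
  have hsub : univ.filter (fun α : Fin n → Fin n => MvpOutcome α π) ⊆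
      univ.filter (fun α => Compatible π α) :=
    monotone_filter_right _ fun _ _ hα => hα.compatible
  constructor
  · intro hcard
    have heq := eq_of_subset_of_card_le hsub hcard.ge
    have hall : ∀ α, Compatible π α → MvpOutcome α π := fun α hα => by
      have hmem : α ∈ univ.filter (fun α => Compatible π α) := by simpa using hα
      simpa [← heq] using hmem
    exact ⟨not_contains321_of_forall_compatible hall, not_contains3412_of_forall_compatible hall⟩
  · rintro ⟨h321, h3412⟩
    congr 1
    exact hsub.antisymm (monotone_filter_right _ fun _ _ hα => hα.mvpOutcome h321 h3412)
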